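/- Fix a measurable partition (C_1,…,C_k) of a cake (C, 𝔉), a player i with true probability measure μ_i, and fixed declarations ν_j for the other players j ≠ i. Let P denote the condition '∀ j ≠ i: ν_j(C_j) > 1/k'. For a declaration ν of player i, her (expected) payoff under Mechanism 2 with this fixed partition is g(ν) = μ_i(C_i) if ν(C_i) > 1/k and P holds, and g(ν) = 1/k otherwise. Then for every declaration ν, g(μ_i) ≥ g(ν); that is, for every fixed choice of the random partition truthful declaration maximizes player i's expected payoff, and hence truth-telling maximizes expected utility in Mechanism 2. -/

import Mathlib

open MeasureTheory
open scoped ENNReal Classical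

/-- Truth-telling maximizes a player's payoff in Mechanism 2 for every fixed choice of
the random partition. Fix a partition piece `Ci` intended for player `i`, her true
probability measure `μ`, and let `Pcond` be the condition that all other players'
declarations value their own pieces above `1/k`. If player `i` declares `ν`, her payoff
is `g ν = μ Ci` when `ν Ci > 1/k` and `Pcond` holds (the partition is accepted as
super-fair), and `1/k` otherwise (Mechanism 1 is used). Then for every declaration `ν`,
`g ν ≤ g μ`; hence truth-telling maximizes expected utility in Mechanism 2. -/
theorem mechanism_two_truthful
    {α : Type*} [MeasurableSpace α] (k : ℕ) (hk : 0 < k)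
    (μ : Measure α) [IsProbabilityMeasure μ]
    (Ci : Set α) (Pcond : Prop)
    (g : Measure α → ℝ)
    (hg : ∀ ν : Measure α, g ν =
      if (k : ℝ≥0∞)⁻¹ < ν Ci ∧ Pcond then (μ Ci).toReal else 1 / k) :
    ∀ ν : Measure α, g ν ≤ g μ := by
  intro ν
  have hk_inv : ((k : ℝ≥0∞)⁻¹).toReal = 1 / k := by simp
  have h_finite : (k : ℝ≥0∞)⁻¹ ≠ ∞ := by simp [hk.ne']
  rw [hg ν, hg μ]
  split_ifs with hν hμ hμ
  · exact le_rfl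
  · have h_le : μ Ci ≤ (k : ℝ≥0∞)⁻¹ := not_lt.mp fun h => hμ ⟨h, hν.2⟩
    exact hk_inv ▸ ENNReal.toReal_mono h_finite h_le
  · exact hk_inv ▸ ENNReal.toReal_mono (measure_ne_top μ Ci) hμ.1.le
  · exact le_rfl
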